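/- Fix n ∈ ℕ, p ≥ 1, and points x₁, …, x_{2n} ∈ ℝ^d with Σ_{i=1}^{2n} x_i = 0. Then W_p((1/(2n)) Σ_{i=1}^{2n} N(x_i, I_d), γ) ≤ (K_p / (1 − (1 − 2^{−2p})^{1/p})) · ((1/(2n)) Σ_{i=1}^{2n} ‖x_i‖^{2p})^{1/p}, where K_p = max{1, C_p/2 + 1/3} and C_p = (E_{ξ∼N(0,1)} |ξ|^p)^{1/p}. -/

import Mathlib

open MeasureTheory ProbabilityTheory Real ENNReal RealInnerProductSpace

noncomputable section

/-- The set of couplings of two measures `μ` and `ν`. -/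
def couplings {E : Type*} [MeasurableSpace E] (μ ν : Measure E) : Set (Measure (E × E)) :=
  {τ | τ.map Prod.fst = μ ∧ τ.map Prod.snd = ν}

/-- The Wasserstein-`p` distance, valued in `ℝ≥0∞`:
`W_p(μ,ν) = (inf over couplings τ of ∫ ‖z₁ - z₂‖^p dτ)^{1/p}`. -/
noncomputable def Wp {E : Type*} [MeasurableSpace E] [NormedAddCommGroup E]
    (p : ℝ) (μ ν : Measure E) : ℝ≥0∞ :=
  (⨅ τ ∈ couplings μ ν, ∫⁻ z : E × E, ENNReal.ofReal (‖z.1 - z.2‖ ^ p) ∂τ) ^ (1 / p)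

/-- The standard Gaussian measure `N(0, I_d)` on `ℝ^d`. -/
noncomputable def stdGaussian (d : ℕ) : Measure (EuclideanSpace ℝ (Fin d)) :=
  (Measure.pi fun _ : Fin d => gaussianReal 0 1).map
    ((EuclideanSpace.equiv (Fin d) ℝ).symm : (Fin d → ℝ) → EuclideanSpace ℝ (Fin d))

/-- The Gaussian measure `N(m, I_d)` on `ℝ^d`. -/
noncomputable def gaussianE (d : ℕ) (m : EuclideanSpace ℝ (Fin d)) :
    Measure (EuclideanSpace ℝ (Fin d)) :=
  (stdGaussian d).map (fun x => m + x)

/-- `C_p = (E_{ξ ∼ N(0,1)} |ξ|^p)^{1/p}`. -/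
noncomputable def Cconst (p : ℝ) : ℝ := (∫ ξ : ℝ, |ξ| ^ p ∂(gaussianReal 0 1)) ^ (1 / p)

/-- `K_p = max {1, C_p/2 + 1/3}`. -/
noncomputable def Kconst (p : ℝ) : ℝ := max 1 (Cconst p / 2 + 1 / 3)

/-- The constant `c₄ = (e⁴ - 5)/16`. -/
noncomputable def cFour : ℝ := (Real.exp 4 - 5) / 16

/-- The (second-moment) covariance matrix `∫ x xᵀ dμ` of a (centred) measure on `ℝ^d`. -/
noncomputable def covMat {d : ℕ} (μ : Measure (EuclideanSpace ℝ (Fin d))) :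
    Matrix (Fin d) (Fin d) ℝ :=
  Matrix.of fun i j => ∫ x, x i * x j ∂μ

/-- The Frobenius norm of a matrix. -/
noncomputable def frob {d : ℕ} (A : Matrix (Fin d) (Fin d) ℝ) : ℝ :=
  Real.sqrt (∑ i, ∑ j, (A i j) ^ 2)

/-- `τ₁ = E[‖X‖ 1_{‖X‖ > 1}]`. -/
noncomputable def tailOne {d : ℕ} (μ : Measure (EuclideanSpace ℝ (Fin d))) : ℝ :=
  ∫ x in {x : EuclideanSpace ℝ (Fin d) | 1 < ‖x‖}, ‖x‖ ∂μ

/-- `τ₂ = (E[‖X‖² 1_{‖X‖ > 1}])^{1/2}`. -/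
noncomputable def tailTwo {d : ℕ} (μ : Measure (EuclideanSpace ℝ (Fin d))) : ℝ :=
  Real.sqrt (∫ x in {x : EuclideanSpace ℝ (Fin d) | 1 < ‖x‖}, ‖x‖ ^ 2 ∂μ)

/-- `m = E[X 1_{‖X‖ ≤ 1}]`. -/
noncomputable def truncMean {d : ℕ} (μ : Measure (EuclideanSpace ℝ (Fin d))) :
    EuclideanSpace ℝ (Fin d) :=
  ∫ x in {x : EuclideanSpace ℝ (Fin d) | ‖x‖ ≤ 1}, x ∂μ

/-- `X̃ = X 1_{‖X‖ ≤ 1} - E[X 1_{‖X‖ ≤ 1}]`, as a function of `X`. -/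
noncomputable def truncCentred {d : ℕ} (μ : Measure (EuclideanSpace ℝ (Fin d)))
    (x : EuclideanSpace ℝ (Fin d)) : EuclideanSpace ℝ (Fin d) :=
  (if ‖x‖ ≤ 1 then x else 0) - truncMean μ

/-- `Σ̃ = Cov(X̃) = E[X̃ X̃ᵀ]` (note `X̃` is centred). -/
noncomputable def truncCov {d : ℕ} (μ : Measure (EuclideanSpace ℝ (Fin d))) :
    Matrix (Fin d) (Fin d) ℝ :=
  Matrix.of fun i j => ∫ x, truncCentred μ x i * truncCentred μ x j ∂μ

/-- The chi-squared divergence `χ²(ρ ‖ γ) = ∫ ((dρ/dγ) - 1)² dγ`. -/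
noncomputable def chiSqDiv {E : Type*} [MeasurableSpace E] (ρ γm : Measure E) : ℝ :=
  ∫ x, ((ρ.rnDeriv γm x).toReal - 1) ^ 2 ∂γm

/-- The Kullback–Leibler divergence `KL(ρ ‖ γ) = ∫ log (dρ/dγ) dρ`. -/
noncomputable def klDivReal {E : Type*} [MeasurableSpace E] (ρ γm : Measure E) : ℝ :=
  ∫ x, Real.log ((ρ.rnDeriv γm x).toReal) ∂ρ

/-- The Jacobian matrix `∇φ(x)` of a map `φ : ℝ^d → ℝ^d`, with entry `(i,j)` equal to
`∂φ_i/∂x_j (x)`. -/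
noncomputable def jacobianM {d : ℕ}
    (φ : EuclideanSpace ℝ (Fin d) → EuclideanSpace ℝ (Fin d))
    (x : EuclideanSpace ℝ (Fin d)) : Matrix (Fin d) (Fin d) ℝ :=
  Matrix.of fun i j => fderiv ℝ φ x (EuclideanSpace.single j (1 : ℝ)) i

/-- `τ` is a Stein kernel for the centred measure `ρ` relative to the standard Gaussian:
for all `φ ∈ C_c^∞(ℝ^d; ℝ^d)`, `E⟨X, φ(X)⟩ = E[tr(τ(X) ∇φ(X))]`. -/
def IsSteinKernel {d : ℕ} (ρ : Measure (EuclideanSpace ℝ (Fin d)))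
    (τ : EuclideanSpace ℝ (Fin d) → Matrix (Fin d) (Fin d) ℝ) : Prop :=
  ∀ φ : EuclideanSpace ℝ (Fin d) → EuclideanSpace ℝ (Fin d),
    ContDiff ℝ (⊤ : ℕ∞) φ → HasCompactSupport φ →
      ∫ x, ⟪x, φ x⟫ ∂ρ = ∫ x, Matrix.trace (τ x * jacobianM φ x) ∂ρ

section Transport

/-- There is a coupling of `μ` and `ν` whose `p`-th moment transport cost is at most `C`. -/
def TransportCostLE {E : Type*} [MeasurableSpace E] [NormedAddCommGroup E]
    (p : ℝ) (μ ν : Measure E) (C : ℝ≥0∞) : Prop :=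
  ∃ τ ∈ couplings μ ν, ∫⁻ z : E × E, ‖z.1 - z.2‖ₑ ^ p ∂τ ≤ C

variable {E : Type*} [MeasurableSpace E] [NormedAddCommGroup E]

theorem TransportCostLE.Wp_le {p : ℝ} (hp : 0 ≤ p) {μ ν : Measure E} {C : ℝ≥0∞}
    (h : TransportCostLE p μ ν C) : Wp p μ ν ≤ C ^ (1 / p) := by
  obtain ⟨τ, hτ, hC⟩ := h
  refine ENNReal.rpow_le_rpow ((iInf₂_le τ hτ).trans (le_trans (le_of_eq ?_) hC)) (by positivity)
  refine lintegral_congr fun z => ?_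
  rw [← ENNReal.ofReal_rpow_of_nonneg (norm_nonneg _) hp, ofReal_norm]

theorem TransportCostLE.mono {p : ℝ} {μ ν : Measure E} {C D : ℝ≥0∞}
    (h : TransportCostLE p μ ν C) (hCD : C ≤ D) : TransportCostLE p μ ν D := by
  obtain ⟨τ, hτ, hC⟩ := h
  exact ⟨τ, hτ, hC.trans hCD⟩

theorem TransportCostLE.smul_sum {ι : Type*} [Fintype ι] {p : ℝ} (c : ℝ≥0∞)
    {μ ν : ι → Measure E} {C : ι → ℝ≥0∞} (h : ∀ i, TransportCostLE p (μ i) (ν i) (C i)) :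
    TransportCostLE p (c • ∑ i, μ i) (c • ∑ i, ν i) (c * ∑ i, C i) := by
  choose τ hτ hC using h
  refine ⟨c • ∑ i, τ i, ⟨?_, ?_⟩, ?_⟩
  · rw [Measure.map_smul, ← Measure.mapₗ_apply_of_measurable measurable_fst, map_sum]
    simp_rw [Measure.mapₗ_apply_of_measurable measurable_fst, (hτ _).1]
  · rw [Measure.map_smul, ← Measure.mapₗ_apply_of_measurable measurable_snd, map_sum]
    simp_rw [Measure.mapₗ_apply_of_measurable measurable_snd, (hτ _).2]
  · rw [lintegral_smul_measure, lintegral_finsetSum_measure, smul_eq_mul]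
    gcongr with i
    exact hC i

variable [BorelSpace E] [SecondCountableTopology E]

theorem transportCostLE_map {Ω : Type*} [MeasurableSpace Ω] (P : Measure Ω) (p : ℝ)
    {f g : Ω → E} (hf : Measurable f) (hg : Measurable g) :
    TransportCostLE p (P.map f) (P.map g) (∫⁻ ω, ‖f ω - g ω‖ₑ ^ p ∂P) := by
  refine ⟨P.map fun ω => (f ω, g ω), ⟨?_, ?_⟩, ?_⟩
  · rw [Measure.map_map measurable_fst (hf.prodMk hg)]; rfl
  · rw [Measure.map_map measurable_snd (hf.prodMk hg)]; rfl
  · rw [lintegral_map (by fun_prop) (hf.prodMk hg)]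

theorem TransportCostLE.map_add_left {p : ℝ} {μ ν : Measure E} {C : ℝ≥0∞}
    (h : TransportCostLE p μ ν C) (m : E) :
    TransportCostLE p (μ.map (m + ·)) (ν.map (m + ·)) C := by
  obtain ⟨τ, ⟨h1, h2⟩, hC⟩ := h
  have := transportCostLE_map τ p (f := fun z : E × E => m + z.1) (g := fun z => m + z.2)
    (by fun_prop) (by fun_prop)
  simp only [add_sub_add_left_eq_sub] at this
  rw [← h1, ← h2, Measure.map_map (by fun_prop) (by fun_prop),
    Measure.map_map (by fun_prop) (by fun_prop)]
  exact this.mono hC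

theorem TransportCostLE.trans [CompleteSpace E] {p : ℝ} (hp : 1 ≤ p) {μ ν ρ : Measure E}
    [IsProbabilityMeasure ν] {a b : ℝ≥0∞}
    (h₁ : TransportCostLE p μ ν (a ^ p)) (h₂ : TransportCostLE p ν ρ (b ^ p)) :
    TransportCostLE p μ ρ ((a + b) ^ p) := by
  obtain ⟨τ₁, ⟨h1, h1'⟩, ha⟩ := h₁
  obtain ⟨τ₂, ⟨h2, h2'⟩, hb⟩ := h₂
  have : IsProbabilityMeasure τ₁ := by
    have : IsProbabilityMeasure (τ₁.map Prod.snd) := by rwa [h1']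
    exact Measure.isProbabilityMeasure_of_map Prod.snd
  have : IsProbabilityMeasure τ₂ := by
    have : IsProbabilityMeasure (τ₂.map Prod.fst) := by rwa [h2]
    exact Measure.isProbabilityMeasure_of_map Prod.fst
  set κ : Kernel E E := τ₂.condKernel
  have hκ : ν ⊗ₘ κ = τ₂ := by
    rw [← h2]; exact τ₂.disintegrate κ
  set σ : Measure ((E × E) × E) := τ₁ ⊗ₘ (κ.comap Prod.snd measurable_snd)
  have hσ₁ : σ.map Prod.fst = τ₁ := Measure.fst_compProd _ _
  have hσ₂ : σ.map (fun z => (z.1.2, z.2)) = τ₂ := by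
    rw [← hκ, ← h1']
    ext s hs
    rw [Measure.map_apply (by fun_prop) hs, Measure.compProd_apply (hs.preimage (by fun_prop)),
      Measure.compProd_apply hs, lintegral_map (Kernel.measurable_kernel_prodMk_left hs)
      measurable_snd]
    rfl
  have key := transportCostLE_map σ p (f := fun z => z.1.1) (g := fun z => z.2)
    (by fun_prop) (by fun_prop)
  have e1 : σ.map (fun z => z.1.1) = μ := by
    rw [← h1, ← hσ₁, Measure.map_map (by fun_prop) (by fun_prop)]; rfl
  have e2 : σ.map (fun z => z.2) = ρ := by
    rw [← h2', ← hσ₂, Measure.map_map (by fun_prop) (by fun_prop)]; rfl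
  rw [e1, e2] at key
  refine key.mono ?_
  have ha' : ∫⁻ z, ‖z.1.1 - z.1.2‖ₑ ^ p ∂σ ≤ a ^ p := by
    rwa [← hσ₁, lintegral_map (by fun_prop) (by fun_prop)] at ha
  have hb' : ∫⁻ z, ‖z.1.2 - z.2‖ₑ ^ p ∂σ ≤ b ^ p := by
    rwa [← hσ₂, lintegral_map (by fun_prop) (by fun_prop)] at hb
  have hp0 : 0 < p := by linarith
  have mink := ENNReal.lintegral_Lp_add_le (μ := σ) (f := fun z => ‖z.1.1 - z.1.2‖ₑ)
    (g := fun z => ‖z.1.2 - z.2‖ₑ) (by fun_prop) (by fun_prop) hp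
  have := calc
    (∫⁻ z, ‖z.1.1 - z.2‖ₑ ^ p ∂σ) ^ (1 / p)
    _ ≤ (∫⁻ z, (‖z.1.1 - z.1.2‖ₑ + ‖z.1.2 - z.2‖ₑ) ^ p ∂σ) ^ (1 / p) := by
        gcongr with z
        rw [← sub_add_sub_cancel z.1.1 z.1.2 z.2]
        exact enorm_add_le _ _
    _ ≤ _ := mink
    _ ≤ (a ^ p) ^ (1 / p) + (b ^ p) ^ (1 / p) := by gcongr
    _ = a + b := by
        rw [one_div, ENNReal.rpow_rpow_inv hp0.ne', ENNReal.rpow_rpow_inv hp0.ne']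
  rw [one_div] at this
  exact (ENNReal.rpow_inv_le_iff hp0).1 this

end Transport

section OneDimensional

/-- The primitive `x ↦ ∫₀ˣ φ` of the standard Gaussian density `φ`. -/
def gaussianPrimitive (x : ℝ) : ℝ := ∫ t in (0 : ℝ)..x, gaussianPDFReal 0 1 t

theorem continuous_gaussianPDFReal : Continuous (gaussianPDFReal 0 1) := by
  unfold gaussianPDFReal; fun_prop

theorem hasDerivAt_gaussianPrimitive (x : ℝ) :
    HasDerivAt gaussianPrimitive (gaussianPDFReal 0 1 x) x :=
  continuous_gaussianPDFReal.integral_hasStrictDerivAt 0 x |>.hasDerivAt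

theorem strictMono_gaussianPrimitive : StrictMono gaussianPrimitive :=
  strictMono_of_deriv_pos fun x => by
    rw [(hasDerivAt_gaussianPrimitive x).deriv]
    exact gaussianPDFReal_pos 0 1 x one_ne_zero

theorem continuous_gaussianPrimitive : Continuous gaussianPrimitive :=
  continuous_iff_continuousAt.2 fun x => (hasDerivAt_gaussianPrimitive x).continuousAt

theorem gaussianPrimitive_neg (x : ℝ) : gaussianPrimitive (-x) = -gaussianPrimitive x := by
  have h := intervalIntegral.integral_comp_neg (a := 0) (b := x) (gaussianPDFReal 0 1)
  rw [neg_zero, intervalIntegral.integral_symm 0 (-x)] at h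
  rw [gaussianPrimitive, gaussianPrimitive, ← neg_eq_iff_eq_neg, ← h]
  simp [gaussianPDFReal]

theorem gaussianReal_real_Iic (x : ℝ) :
    (gaussianReal 0 1).real (Set.Iic x) =
      (gaussianReal 0 1).real (Set.Iic 0) + gaussianPrimitive x := by
  have h (y : ℝ) : (gaussianReal 0 1).real (Set.Iic y) =
      ∫ t in Set.Iic y, gaussianPDFReal 0 1 t := by
    rw [Measure.real, gaussianReal_apply_eq_integral 0 one_ne_zero, ENNReal.toReal_ofReal]
    exact integral_nonneg fun t => gaussianPDFReal_nonneg 0 1 t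
  rw [h, h, gaussianPrimitive, ← intervalIntegral.integral_Iic_sub_Iic
    (integrable_gaussianPDFReal 0 1).integrableOn (integrable_gaussianPDFReal 0 1).integrableOn]
  ring

/-- Up to an additive constant, the distribution function of the mixture
`½ N(v, 1) + ½ N(-v, 1)`. -/
def mixturePrimitive (v y : ℝ) : ℝ := (gaussianPrimitive (y - v) + gaussianPrimitive (y + v)) / 2

theorem continuous_mixturePrimitive (v : ℝ) : Continuous (mixturePrimitive v) := by
  have := continuous_gaussianPrimitive
  unfold mixturePrimitive
  fun_prop

theorem strictMono_mixturePrimitive (v : ℝ) : StrictMono (mixturePrimitive v) := fun a b hab => by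
  have h1 := strictMono_gaussianPrimitive (sub_lt_sub_right hab v)
  have h2 := strictMono_gaussianPrimitive (add_lt_add_left hab v)
  unfold mixturePrimitive
  linarith

theorem mixturePrimitive_neg (v y : ℝ) : mixturePrimitive v (-y) = -mixturePrimitive v y := by
  rw [mixturePrimitive, mixturePrimitive, show -y - v = -(y + v) by ring,
    show -y + v = -(y - v) by ring, gaussianPrimitive_neg, gaussianPrimitive_neg]
  ring

theorem exists_gaussianPrimitive_eq_mixturePrimitive (v y : ℝ) :
    ∃ x, gaussianPrimitive x = mixturePrimitive v y := by
  have key (a b : ℝ) (hab : a ≤ b) :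
      ∃ x, gaussianPrimitive x = (gaussianPrimitive a + gaussianPrimitive b) / 2 := by
    have hm := strictMono_gaussianPrimitive.monotone hab
    obtain ⟨x, -, hx⟩ := intermediate_value_Icc hab continuous_gaussianPrimitive.continuousOn
      (show (gaussianPrimitive a + gaussianPrimitive b) / 2 ∈ Set.Icc _ _ from
        ⟨by linarith, by linarith⟩)
    exact ⟨x, hx⟩
  rcases le_total (y - v) (y + v) with h | h
  · exact key _ _ h
  · obtain ⟨x, hx⟩ := key _ _ h
    exact ⟨x, by rw [hx, mixturePrimitive, add_comm]⟩

theorem gaussianPDFReal_add_eq (y u : ℝ) : gaussianPDFReal 0 1 (y + u) =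
    gaussianPDFReal 0 1 y * rexp (-u ^ 2 / 2) * rexp (-(u * y)) := by
  simp only [gaussianPDFReal, mul_assoc, ← Real.exp_add]
  congr 2
  simp only [NNReal.coe_one]
  ring

theorem gaussianPDFReal_sub_eq (y u : ℝ) : gaussianPDFReal 0 1 (y - u) =
    gaussianPDFReal 0 1 y * rexp (-u ^ 2 / 2) * rexp (u * y) := by
  rw [sub_eq_add_neg, gaussianPDFReal_add_eq]
  simp

theorem sinh_le_mul_cosh {a : ℝ} (ha : 0 ≤ a) : Real.sinh a ≤ a * Real.cosh a := by
  have hd (t : ℝ) : HasDerivAt (fun t => t * Real.cosh t - Real.sinh t) (t * Real.sinh t) t := by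
    convert! ((hasDerivAt_id t).mul (Real.hasDerivAt_cosh t)).sub (Real.hasDerivAt_sinh t) using 1
    simp
  have hm : MonotoneOn (fun t => t * Real.cosh t - Real.sinh t) (Set.Ici 0) := by
    refine monotoneOn_of_deriv_nonneg (convex_Ici 0)
      (fun t _ => (hd t).continuousAt.continuousWithinAt)
      (fun t _ => (hd t).differentiableAt.differentiableWithinAt) fun t ht => ?_
    rw [interior_Ici, Set.mem_Ioi] at ht
    rw [(hd t).deriv]
    exact mul_nonneg ht.le (Real.sinh_nonneg_iff.2 ht.le)
  have := hm (Set.mem_Ici.2 le_rfl) (Set.mem_Ici.2 ha) ha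
  simp at this
  linarith

theorem mixturePrimitive_le {v x : ℝ} (hv : 0 ≤ v) (hx : 0 ≤ x) :
    mixturePrimitive v x ≤ gaussianPrimitive x := by
  have hd (u : ℝ) : HasDerivAt (fun u => mixturePrimitive u x)
      ((gaussianPDFReal 0 1 (x - u) * -1 + gaussianPDFReal 0 1 (x + u) * 1) / 2) u :=
    (((hasDerivAt_gaussianPrimitive (x - u)).comp u ((hasDerivAt_id u).const_sub x)).add
      ((hasDerivAt_gaussianPrimitive (x + u)).comp u ((hasDerivAt_id u).const_add x))).div_const 2
  have hm : AntitoneOn (fun u => mixturePrimitive u x) (Set.Ici 0) := by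
    refine antitoneOn_of_deriv_nonpos (convex_Ici 0)
      (fun t _ => (hd t).continuousAt.continuousWithinAt)
      (fun t _ => (hd t).differentiableAt.differentiableWithinAt) fun t ht => ?_
    rw [interior_Ici, Set.mem_Ioi] at ht
    rw [(hd t).deriv, gaussianPDFReal_add_eq, gaussianPDFReal_sub_eq]
    have h1 : rexp (-(t * x)) ≤ rexp (t * x) :=
      Real.exp_le_exp.2 (by have := mul_nonneg ht.le hx; linarith)
    have h2 : 0 ≤ gaussianPDFReal 0 1 x * rexp (-t ^ 2 / 2) :=
      mul_nonneg (gaussianPDFReal_nonneg _ _ _) (Real.exp_pos _).le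
    have := mul_le_mul_of_nonneg_left h1 h2
    linarith
  have := hm (Set.mem_Ici.2 le_rfl) (Set.mem_Ici.2 hv) hv
  simpa [mixturePrimitive] using this

theorem sinh_le_of_le {u x : ℝ} (hu : 0 ≤ u) (hx : 0 ≤ x) :
    Real.sinh (u * (x + u ^ 2 * x / 2 + u ^ 3 / 3)) ≤
      (u * x + u ^ 2) * Real.cosh (u * (x + u ^ 2 * x / 2 + u ^ 3 / 3)) := by
  set a := u * (x + u ^ 2 * x / 2 + u ^ 3 / 3) with ha
  have ha0 : 0 ≤ a := by positivity
  have hux : 0 ≤ u * x := by positivity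
  rcases le_total 1 (u * x + u ^ 2) with h | h
  · have := Real.sinh_lt_cosh a
    nlinarith [Real.cosh_pos a]
  · have hab : a ≤ u * x + u ^ 2 := by
      have h' : u * x / 2 + u ^ 2 / 3 ≤ 1 := by nlinarith
      have := mul_le_mul_of_nonneg_left h' (sq_nonneg u)
      rw [ha]
      nlinarith
    exact (sinh_le_mul_cosh ha0).trans (mul_le_mul_of_nonneg_right hab (Real.cosh_pos a).le)

theorem gaussianPrimitive_le_mixturePrimitive {v x : ℝ} (hv : 0 ≤ v) (hx : 0 ≤ x) :
    gaussianPrimitive x ≤ mixturePrimitive v (x + v ^ 2 * x / 2 + v ^ 3 / 3) := by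
  have hy (u : ℝ) : HasDerivAt (fun u => x + u ^ 2 * x / 2 + u ^ 3 / 3) (u * x + u ^ 2) u := by
    convert! ((((hasDerivAt_pow 2 u).mul_const x).div_const 2).const_add x).add
      ((hasDerivAt_pow 3 u).div_const 3) using 1
    norm_num
    ring
  set y : ℝ → ℝ := fun u => x + u ^ 2 * x / 2 + u ^ 3 / 3 with hy_def
  have hd (u : ℝ) : HasDerivAt (fun u => mixturePrimitive u (y u))
      ((gaussianPDFReal 0 1 (y u - u) * (u * x + u ^ 2 - 1) +
        gaussianPDFReal 0 1 (y u + u) * (u * x + u ^ 2 + 1)) / 2) u :=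
    (((hasDerivAt_gaussianPrimitive (y u - u)).comp (h := fun u => y u - u) u
      ((hy u).sub (hasDerivAt_id u))).add
      ((hasDerivAt_gaussianPrimitive (y u + u)).comp (h := fun u => y u + u) u
        ((hy u).add (hasDerivAt_id u)))).div_const 2
  have hm : MonotoneOn (fun u => mixturePrimitive u (y u)) (Set.Ici 0) := by
    refine monotoneOn_of_deriv_nonneg (convex_Ici 0)
      (fun t _ => (hd t).continuousAt.continuousWithinAt)
      (fun t _ => (hd t).differentiableAt.differentiableWithinAt) fun t ht => ?_
    rw [interior_Ici, Set.mem_Ioi] at ht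
    rw [(hd t).deriv, gaussianPDFReal_add_eq, gaussianPDFReal_sub_eq]
    have h1 := sinh_le_of_le ht.le hx
    change Real.sinh (t * y t) ≤ (t * x + t ^ 2) * Real.cosh (t * y t) at h1
    rw [Real.sinh_eq, Real.cosh_eq] at h1
    have h2 : 0 ≤ gaussianPDFReal 0 1 (y t) * rexp (-t ^ 2 / 2) :=
      mul_nonneg (gaussianPDFReal_nonneg _ _ _) (Real.exp_pos _).le
    have := mul_le_mul_of_nonneg_left h1 h2
    linarith
  have := hm (Set.mem_Ici.2 le_rfl) (Set.mem_Ici.2 hv) hv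
  simpa [mixturePrimitive, hy_def] using this

theorem exists_mixturePrimitive_eq {v : ℝ} (hv : 0 ≤ v) (hv1 : v ≤ 1) (x : ℝ) :
    ∃ y, mixturePrimitive v y = gaussianPrimitive x ∧ |y - x| ≤ v ^ 2 * (|x| / 2 + 1 / 3) := by
  have key {x : ℝ} (hx : 0 ≤ x) :
      ∃ y, mixturePrimitive v y = gaussianPrimitive x ∧ |y - x| ≤ v ^ 2 * (|x| / 2 + 1 / 3) := by
    have h0 : 0 ≤ v ^ 2 * x / 2 + v ^ 3 / 3 := by positivity
    obtain ⟨y, hy, hyx⟩ := intermediate_value_Icc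
      (show x ≤ x + v ^ 2 * x / 2 + v ^ 3 / 3 by linarith)
      (continuous_mixturePrimitive v).continuousOn
      ⟨mixturePrimitive_le hv hx, gaussianPrimitive_le_mixturePrimitive hv hx⟩
    refine ⟨y, hyx, ?_⟩
    rw [abs_of_nonneg hx, abs_of_nonneg (by linarith [hy.1])]
    have : v ^ 3 ≤ v ^ 2 := pow_le_pow_of_le_one hv hv1 (by norm_num)
    linarith [hy.2]
  rcases le_total 0 x with hx | hx
  · exact key hx
  · obtain ⟨y, h1, h2⟩ := key (neg_nonneg.2 hx)
    refine ⟨-y, ?_, ?_⟩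
    · rw [mixturePrimitive_neg, h1, gaussianPrimitive_neg, neg_neg]
    · rwa [abs_neg, ← abs_neg, show -(y - -x) = -y - x by ring] at h2

/-- A monotone transport map from `N(0, 1)` to `½ N(v, 1) + ½ N(-v, 1)` that is close to the
identity. -/
theorem exists_transport_map {v : ℝ} (hv : 0 ≤ v) (hv1 : v ≤ 1) :
    ∃ T : ℝ → ℝ, Measurable T ∧
      (gaussianReal 0 1).map T = (2 : ℝ≥0∞)⁻¹ •
        ((gaussianReal 0 1).map (v + ·) + (gaussianReal 0 1).map (-v + ·)) ∧
      ∀ x, |T x - x| ≤ v ^ 2 * (|x| / 2 + 1 / 3) := by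
  choose T hT hTx using exists_mixturePrimitive_eq hv hv1
  have hle (x y : ℝ) : T x ≤ T y ↔ x ≤ y := by
    rw [← (strictMono_mixturePrimitive v).le_iff_le, hT, hT,
      strictMono_gaussianPrimitive.le_iff_le]
  have hmeas : Measurable T := Monotone.measurable fun x y h => (hle x y).2 h
  have hmass : ((2 : ℝ≥0∞)⁻¹ • ((gaussianReal 0 1).map (v + ·) +
      (gaussianReal 0 1).map (-v + ·))) Set.univ = 1 := by
    rw [Measure.smul_apply, Measure.add_apply, Measure.map_apply (by fun_prop) .univ,
      Measure.map_apply (by fun_prop) .univ]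
    simp [one_add_one_eq_two, ENNReal.inv_mul_cancel]
  have : IsProbabilityMeasure ((gaussianReal 0 1).map T) :=
    Measure.isProbabilityMeasure_map hmeas.aemeasurable
  refine ⟨T, hmeas, ?_, hTx⟩
  refine Measure.ext_of_Iic _ _ fun y => ?_
  obtain ⟨x, hx⟩ := exists_gaussianPrimitive_eq_mixturePrimitive v y
  obtain rfl : T x = y := (strictMono_mixturePrimitive v).injective ((hT x).trans hx)
  have hpre : T ⁻¹' Set.Iic (T x) = Set.Iic x := by ext z; simp [hle]
  have hpre1 : (v + ·) ⁻¹' Set.Iic (T x) = Set.Iic (T x - v) := by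
    ext z; simp [le_sub_iff_add_le']
  have hpre2 : (-v + ·) ⁻¹' Set.Iic (T x) = Set.Iic (T x + v) := by
    ext z; simp [add_comm]
  rw [Measure.map_apply hmeas measurableSet_Iic, hpre, Measure.smul_apply, Measure.add_apply,
    Measure.map_apply (by fun_prop) measurableSet_Iic,
    Measure.map_apply (by fun_prop) measurableSet_Iic, hpre1, hpre2]
  rw [← ENNReal.toReal_eq_toReal_iff' (by simp) (by
      simp [ENNReal.mul_eq_top])]
  rw [smul_eq_mul, ENNReal.toReal_mul, ENNReal.toReal_add (by simp) (by simp)]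
  have e1 := gaussianReal_real_Iic x
  have e2 := gaussianReal_real_Iic (T x - v)
  have e3 := gaussianReal_real_Iic (T x + v)
  simp only [Measure.real] at e1 e2 e3
  rw [e1, e2, e3, hx, mixturePrimitive]
  simp
  ring

end OneDimensional

section TwoPoint

variable {E : Type*} [NormedAddCommGroup E] [InnerProductSpace ℝ E] [FiniteDimensional ℝ E]
  [MeasurableSpace E] [BorelSpace E]

theorem map_prod_stdGaussian {e : E} (he : ‖e‖ = 1) :
    ((gaussianReal 0 1).prod (ProbabilityTheory.stdGaussian E)).map
      (fun q => q.1 • e + (q.2 - ⟪e, q.2⟫ • e)) = ProbabilityTheory.stdGaussian E := by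
  have hcont : Continuous fun q : ℝ × E => q.1 • e + (q.2 - ⟪e, q.2⟫ • e) := by fun_prop
  have : IsProbabilityMeasure (((gaussianReal 0 1).prod (ProbabilityTheory.stdGaussian E)).map
      (fun q => q.1 • e + (q.2 - ⟪e, q.2⟫ • e))) :=
    Measure.isProbabilityMeasure_map hcont.measurable.aemeasurable
  refine Measure.ext_of_charFun (funext fun t => ?_)
  rw [charFun_apply, integral_map hcont.measurable.aemeasurable
    (Measurable.aestronglyMeasurable (by fun_prop))]
  have h (q : ℝ × E) : Complex.exp (⟪q.1 • e + (q.2 - ⟪e, q.2⟫ • e), t⟫ * Complex.I) =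
      Complex.exp (⟪e, t⟫ * q.1 * Complex.I) *
        Complex.exp (⟪q.2, t - ⟪e, t⟫ • e⟫ * Complex.I) := by
    rw [← Complex.exp_add, ← add_mul]
    congr 2
    simp only [inner_add_left, inner_sub_left, inner_sub_right, real_inner_smul_left,
      real_inner_smul_right, real_inner_comm e q.2]
    push_cast
    ring
  simp_rw [h]
  rw [integral_prod_mul (fun s : ℝ => Complex.exp (⟪e, t⟫ * s * Complex.I))
    (fun z : E => Complex.exp (⟪z, t - ⟪e, t⟫ • e⟫ * Complex.I)),
    ← charFun_apply_real, ← charFun_apply, charFun_gaussianReal, charFun_stdGaussian,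
    charFun_stdGaussian, ← Complex.exp_add]
  congr 1
  have h2 : ‖t - ⟪e, t⟫ • e‖ ^ 2 = ‖t‖ ^ 2 - ⟪e, t⟫ ^ 2 := by
    rw [norm_sub_sq_real, real_inner_smul_right, norm_smul, he, real_inner_comm e t]
    simp
    ring
  rw [← Complex.ofReal_pow ‖t - _‖, h2]
  push_cast
  ring

theorem ofReal_Cconst {p : ℝ} (hp : 0 < p) :
    ENNReal.ofReal (Cconst p) = eLpNorm id (ENNReal.ofReal p) (gaussianReal 0 1) := by
  rw [(memLp_id_gaussianReal' (ENNReal.ofReal p) ENNReal.ofReal_ne_top).eLpNorm_eq_integral_rpow_norm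
    (by simpa using hp) ENNReal.ofReal_ne_top, ENNReal.toReal_ofReal hp.le, Cconst, one_div]
  rfl

theorem lintegral_affine_gaussianReal_le {p : ℝ} (hp : 1 ≤ p) {c : ℝ} (hc : 0 ≤ c) {g : ℝ → ℝ}
    (hg : ∀ x, |g x| ≤ c * (|x| / 2 + 1 / 3)) :
    ∫⁻ x, ‖g x‖ₑ ^ p ∂(gaussianReal 0 1) ≤ ENNReal.ofReal (Kconst p * c) ^ p := by
  have hp0 : 0 < p := by linarith
  have hP0 : ENNReal.ofReal p ≠ 0 := by simpa using hp0
  have hC : 0 ≤ Cconst p :=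
    Real.rpow_nonneg (integral_nonneg fun _ => Real.rpow_nonneg (abs_nonneg _) _) _
  rw [← ENNReal.rpow_inv_le_iff hp0, ← one_div]
  have e1 := eLpNorm_eq_lintegral_rpow_enorm_toReal hP0 ENNReal.ofReal_ne_top
    (f := g) (μ := gaussianReal 0 1)
  rw [ENNReal.toReal_ofReal hp0.le] at e1
  rw [← e1]
  calc eLpNorm g (ENNReal.ofReal p) (gaussianReal 0 1)
    _ ≤ eLpNorm (c • (((2⁻¹ : ℝ) • fun x : ℝ => ‖id x‖) + fun _ => (1 / 3 : ℝ)))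
          (ENNReal.ofReal p) (gaussianReal 0 1) := by
        refine eLpNorm_mono_real fun x => (hg x).trans (le_of_eq ?_)
        change _ = c * (2⁻¹ * |x| + 1 / 3)
        ring
    _ = ‖c‖ₑ * eLpNorm (((2⁻¹ : ℝ) • fun x : ℝ => ‖id x‖) + fun _ => (1 / 3 : ℝ))
          (ENNReal.ofReal p) (gaussianReal 0 1) := eLpNorm_const_smul _ _ _ _
    _ ≤ ‖c‖ₑ * (eLpNorm ((2⁻¹ : ℝ) • fun x : ℝ => ‖id x‖) (ENNReal.ofReal p) (gaussianReal 0 1) +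
          eLpNorm (fun _ => (1 / 3 : ℝ)) (ENNReal.ofReal p) (gaussianReal 0 1)) := by
        gcongr
        exact eLpNorm_add_le (Measurable.aestronglyMeasurable (by fun_prop))
          (Measurable.aestronglyMeasurable (by fun_prop)) (by simpa using hp)
    _ = ENNReal.ofReal ((Cconst p / 2 + 1 / 3) * c) := by
        rw [eLpNorm_const_smul, eLpNorm_norm, ← ofReal_Cconst hp0,
          eLpNorm_const _ hP0 (IsProbabilityMeasure.ne_zero _), measure_univ, ENNReal.one_rpow,
          mul_one, Real.enorm_of_nonneg hc, Real.enorm_of_nonneg (by norm_num),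
          Real.enorm_of_nonneg (by norm_num), ← ENNReal.ofReal_mul (by norm_num),
          ← ENNReal.ofReal_add (by positivity) (by norm_num), ← ENNReal.ofReal_mul hc]
        congr 1
        ring
    _ ≤ ENNReal.ofReal (Kconst p * c) := by
        gcongr
        exact le_max_right _ _

theorem transportCostLE_translate {ι : Type*} [Fintype ι] (p : ℝ) (c : ℝ≥0∞) (μ : Measure E)
    (x : ι → E) :
    TransportCostLE p (c • ∑ i, μ.map (x i + ·)) (c • ∑ _i : ι, μ) (c * ∑ i, ‖x i‖ₑ ^ p * μ Set.univ) := by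
  refine TransportCostLE.smul_sum c fun i => ?_
  simpa using transportCostLE_map μ p (f := (x i + ·)) (g := id) (by fun_prop) (by fun_prop)

theorem transportCostLE_symmetric_pair {p : ℝ} (hp : 1 ≤ p) (w : E) :
    TransportCostLE p ((2 : ℝ≥0∞)⁻¹ • ((ProbabilityTheory.stdGaussian E).map (w + ·) +
        (ProbabilityTheory.stdGaussian E).map (-w + ·))) (ProbabilityTheory.stdGaussian E)
      (ENNReal.ofReal (Kconst p * ‖w‖ ^ 2) ^ p) := by
  set γ := ProbabilityTheory.stdGaussian E
  have hp0 : 0 < p := by linarith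
  by_cases hw : 0 < ‖w‖ ∧ ‖w‖ ≤ 1
  · obtain ⟨T, hTm, hT, hTx⟩ := exists_transport_map (norm_nonneg w) hw.2
    set e : E := ‖w‖⁻¹ • w
    have he : ‖e‖ = 1 := by
      rw [norm_smul, norm_inv, norm_norm, inv_mul_cancel₀ hw.1.ne']
    have hwe : ‖w‖ • e = w := smul_inv_smul₀ hw.1.ne' w
    set A : ℝ × E → E := fun q => q.1 • e + (q.2 - ⟪e, q.2⟫ • e)
    have hA : Measurable A := by fun_prop
    have hAγ : ((gaussianReal 0 1).prod γ).map A = γ := map_prod_stdGaussian he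
    have hshift (s : ℝ) : (((gaussianReal 0 1).map (s + ·)).prod γ).map A =
        γ.map (s • e + ·) := by
      conv_rhs => rw [← hAγ]
      conv_lhs => rw [← Measure.map_id (μ := γ)]
      rw [Measure.map_prod_map _ _ (by fun_prop) measurable_id,
        Measure.map_map hA (by fun_prop), Measure.map_map (by fun_prop) hA]
      congr 1
      ext q
      simp only [A, Function.comp, Prod.map, id, add_smul]
      abel
    have key := transportCostLE_map ((gaussianReal 0 1).prod γ) p
      (f := A ∘ Prod.map T id) (g := A) (hA.comp (hTm.prodMap measurable_id)) hA
    have hB : ((gaussianReal 0 1).prod γ).map (A ∘ Prod.map T id) =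
        (2 : ℝ≥0∞)⁻¹ • (γ.map (w + ·) + γ.map (-w + ·)) := by
      rw [← Measure.map_map hA (hTm.prodMap measurable_id),
        ← Measure.map_prod_map _ _ hTm measurable_id, Measure.map_id, hT, Measure.prod_smul_left,
        Measure.map_smul, Measure.add_prod, Measure.map_add _ _ hA, hshift, hshift, neg_smul, hwe]
    rw [hB, hAγ] at key
    refine key.mono ?_
    have hdiff (q : ℝ × E) : ‖(A ∘ Prod.map T id) q - A q‖ₑ ^ p = ‖T q.1 - q.1‖ₑ ^ p := by
      have : (A ∘ Prod.map T id) q - A q = (T q.1 - q.1) • e := by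
        simp only [A, Function.comp, Prod.map, id, sub_smul]
        abel
      rw [this, enorm_smul, show ‖e‖ₑ = 1 by rw [← ofReal_norm, he, ENNReal.ofReal_one], mul_one]
    simp_rw [hdiff]
    have hfst : ((gaussianReal 0 1).prod γ).map Prod.fst = gaussianReal 0 1 := by
      rw [Measure.map_fst_prod]; simp
    have := lintegral_affine_gaussianReal_le hp (sq_nonneg ‖w‖) hTx
    rwa [← hfst, lintegral_map (by fun_prop) measurable_fst] at this
  · have hsq : ‖w‖ ≤ ‖w‖ ^ 2 := by
      rw [not_and_or, not_lt, not_le] at hw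
      rcases hw with h | h
      · rw [le_antisymm h (norm_nonneg w)]; simp
      · nlinarith
    have h := transportCostLE_translate p 2⁻¹ γ (fun b : Bool => if b then w else -w)
    simp only [Fintype.sum_bool, if_true, measure_univ, mul_one, ← two_mul, enorm_neg,
      Bool.false_eq_true, if_false] at h
    have e2 : (2 : ℝ≥0∞)⁻¹ • (γ + γ) = γ := by
      rw [← two_smul ℝ≥0∞ γ, smul_smul, ENNReal.inv_mul_cancel (by simp) (by simp), one_smul]
    rw [e2, ← mul_assoc, ENNReal.inv_mul_cancel (by simp) (by simp), one_mul] at h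
    refine h.mono ?_
    rw [← ofReal_norm]
    gcongr
    refine hsq.trans (le_mul_of_one_le_left (sq_nonneg _) (le_max_left _ _))

theorem transportCostLE_pair {p : ℝ} (hp : 1 ≤ p) (a b : E) :
    TransportCostLE p ((2 : ℝ≥0∞)⁻¹ • ((ProbabilityTheory.stdGaussian E).map (a + ·) +
        (ProbabilityTheory.stdGaussian E).map (b + ·)))
      ((ProbabilityTheory.stdGaussian E).map ((2⁻¹ : ℝ) • (a + b) + ·))
      (ENNReal.ofReal (Kconst p * ‖(2⁻¹ : ℝ) • (a - b)‖ ^ 2) ^ p) := by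
  have h := (transportCostLE_symmetric_pair hp ((2⁻¹ : ℝ) • (a - b))).map_add_left
    ((2⁻¹ : ℝ) • (a + b))
  rw [Measure.map_smul, Measure.map_add _ _ (by fun_prop), Measure.map_map (by fun_prop)
    (by fun_prop), Measure.map_map (by fun_prop) (by fun_prop)] at h
  have ha : (fun z : E => (2⁻¹ : ℝ) • (a + b) + z) ∘ (fun z => (2⁻¹ : ℝ) • (a - b) + z) =
      (a + ·) := funext fun z => by simp only [Function.comp]; module
  have hb : (fun z : E => (2⁻¹ : ℝ) • (a + b) + z) ∘ (fun z => -((2⁻¹ : ℝ) • (a - b)) + z) =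
      (b + ·) := funext fun z => by simp only [Function.comp]; module
  rwa [ha, hb] at h

end TwoPoint

section Averages

variable {E : Type*} [NormedAddCommGroup E] {ι : Type*} [Fintype ι]

/-- The average `(1/|ι|) ∑ᵢ ‖xᵢ‖^q`. -/
def meanNormRpow (q : ℝ) (x : ι → E) : ℝ :=
  (Fintype.card ι : ℝ)⁻¹ * ∑ i, ‖x i‖ ^ q

theorem meanNormRpow_nonneg (q : ℝ) (x : ι → E) : 0 ≤ meanNormRpow q x :=
  mul_nonneg (by positivity) (Finset.sum_nonneg fun _ _ => by positivity)

theorem meanNormRpow_le_sqrt [Nonempty ι] (p : ℝ) (x : ι → E) :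
    meanNormRpow p x ≤ meanNormRpow (2 * p) x ^ (1 / 2 : ℝ) := by
  have hN : (0 : ℝ) < Fintype.card ι := by exact_mod_cast Fintype.card_pos
  rw [← Real.sqrt_eq_rpow]
  refine Real.le_sqrt_of_sq_le ?_
  have hsq (i : ι) : ‖x i‖ ^ (2 * p) = (‖x i‖ ^ p) ^ 2 := by
    rw [mul_comm, Real.rpow_mul (norm_nonneg _), Real.rpow_two]
  have h := sq_sum_le_card_mul_sum_sq (s := Finset.univ) (f := fun i => ‖x i‖ ^ p)
  rw [meanNormRpow, meanNormRpow, mul_pow]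
  simp_rw [hsq]
  refine (mul_le_mul_of_nonneg_left h (by positivity)).trans (le_of_eq ?_)
  rw [Finset.card_univ]
  field_simp

theorem inv_card_mul_sum_enorm_rpow {q : ℝ} (hq : 0 ≤ q) [Nonempty ι] (x : ι → E) :
    (Fintype.card ι : ℝ≥0∞)⁻¹ * ∑ i, ‖x i‖ₑ ^ q = ENNReal.ofReal (meanNormRpow q x) := by
  have hN : (0 : ℝ) < Fintype.card ι := by exact_mod_cast Fintype.card_pos
  rw [meanNormRpow, ENNReal.ofReal_mul (by positivity), ENNReal.ofReal_inv_of_pos hN,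
    ENNReal.ofReal_natCast, ENNReal.ofReal_sum_of_nonneg fun _ _ => by positivity]
  congr 2 with i
  rw [← ENNReal.ofReal_rpow_of_nonneg (norm_nonneg _) hq, ofReal_norm]

variable [InnerProductSpace ℝ E]

/-- The family of pairwise midpoints of a family of points. -/
def midpoints (x : ι → E) (q : ι × ι) : E := (2⁻¹ : ℝ) • (x q.1 + x q.2)

/-- The family of pairwise half differences of a family of points. -/
def halfDifferences (x : ι → E) (q : ι × ι) : E := (2⁻¹ : ℝ) • (x q.1 - x q.2)

/-- Clarkson's inequality in an inner product space. -/
theorem norm_half_add_rpow_add_norm_half_sub_rpow_le {p : ℝ} (hp : 1 ≤ p) (a b : E) :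
    ‖(2⁻¹ : ℝ) • (a + b)‖ ^ (2 * p) + ‖(2⁻¹ : ℝ) • (a - b)‖ ^ (2 * p) ≤
      (‖a‖ ^ (2 * p) + ‖b‖ ^ (2 * p)) / 2 := by
  have hsq (z : E) : ‖z‖ ^ (2 * p) = (‖z‖ ^ 2) ^ p := by
    rw [Real.rpow_mul (norm_nonneg z), Real.rpow_two]
  simp_rw [hsq]
  have hpar : ‖(2⁻¹ : ℝ) • (a + b)‖ ^ 2 + ‖(2⁻¹ : ℝ) • (a - b)‖ ^ 2 =
      (1 / 2) * ‖a‖ ^ 2 + (1 / 2) * ‖b‖ ^ 2 := by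
    have := parallelogram_law_with_norm ℝ a b
    rw [norm_smul, norm_smul, mul_pow, mul_pow]
    norm_num
    linarith
  refine (Real.add_rpow_le_rpow_add (sq_nonneg _) (sq_nonneg _) hp).trans ?_
  rw [hpar]
  have := (convexOn_rpow hp).2 (Set.mem_Ici.2 (sq_nonneg ‖a‖)) (Set.mem_Ici.2 (sq_nonneg ‖b‖))
    (show (0 : ℝ) ≤ 1 / 2 by norm_num) (show (0 : ℝ) ≤ 1 / 2 by norm_num) (by norm_num)
  simp only [smul_eq_mul] at this
  linarith

theorem meanNormRpow_midpoints_add_halfDifferences_le [Nonempty ι] {p : ℝ} (hp : 1 ≤ p)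
    (x : ι → E) : meanNormRpow (2 * p) (midpoints x) + meanNormRpow (2 * p) (halfDifferences x) ≤
      meanNormRpow (2 * p) x := by
  have hN : (0 : ℝ) < Fintype.card ι := by exact_mod_cast Fintype.card_pos
  have h : ∑ q : ι × ι, ‖midpoints x q‖ ^ (2 * p) + ∑ q : ι × ι, ‖halfDifferences x q‖ ^ (2 * p) ≤
      Fintype.card ι * ∑ i, ‖x i‖ ^ (2 * p) := by
    rw [← Finset.sum_add_distrib]
    refine (Finset.sum_le_sum fun q _ =>
      norm_half_add_rpow_add_norm_half_sub_rpow_le hp (x q.1) (x q.2)).trans (le_of_eq ?_)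
    rw [Fintype.sum_prod_type]
    simp only [← Finset.sum_div, Finset.sum_add_distrib, Finset.sum_const, Finset.card_univ,
      nsmul_eq_mul, ← Finset.mul_sum]
    ring
  rw [meanNormRpow, meanNormRpow, meanNormRpow, ← mul_add, Fintype.card_prod]
  push_cast
  refine (mul_le_mul_of_nonneg_left h (by positivity)).trans (le_of_eq ?_)
  field_simp

theorem two_rpow_mul_meanNormRpow_le [Nonempty ι] {q : ℝ} (hq : 1 ≤ q) {x : ι → E}
    (hx : ∑ i, x i = 0) :
    (2 : ℝ) ^ (-q) * meanNormRpow q x ≤ meanNormRpow q (halfDifferences x) := by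
  have hN : (0 : ℝ) < Fintype.card ι := by exact_mod_cast Fintype.card_pos
  have h (i : ι) : ‖x i‖ ^ q ≤ ∑ j, (Fintype.card ι : ℝ)⁻¹ * ‖x i - x j‖ ^ q := by
    have hmean : x i = ∑ j, (Fintype.card ι : ℝ)⁻¹ • (x i - x j) := by
      rw [← Finset.smul_sum, Finset.sum_sub_distrib, hx, sub_zero, Finset.sum_const,
        Finset.card_univ, ← Nat.cast_smul_eq_nsmul ℝ, inv_smul_smul₀ hN.ne']
    have hle : ‖x i‖ ≤ ∑ j, (Fintype.card ι : ℝ)⁻¹ * ‖x i - x j‖ := by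
      conv_lhs => rw [hmean]
      refine (norm_sum_le _ _).trans (le_of_eq (Finset.sum_congr rfl fun j _ => ?_))
      rw [norm_smul, Real.norm_of_nonneg (by positivity)]
    refine (Real.rpow_le_rpow (norm_nonneg _) hle (by linarith)).trans ?_
    refine Real.rpow_arith_mean_le_arith_mean_rpow _ _ _ (fun _ _ => by positivity) ?_
      (fun _ _ => norm_nonneg _) hq
    simp [hN.ne']
  have hhalf (i j : ι) : ‖halfDifferences x (i, j)‖ ^ q = (2 : ℝ) ^ (-q) * ‖x i - x j‖ ^ q := by
    rw [halfDifferences, norm_smul, Real.mul_rpow (norm_nonneg _) (norm_nonneg _),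
      Real.rpow_neg (by norm_num), Real.norm_of_nonneg (by norm_num), Real.inv_rpow (by norm_num)]
  rw [meanNormRpow, meanNormRpow, Fintype.card_prod, Fintype.sum_prod_type]
  simp_rw [hhalf, ← Finset.mul_sum]
  have := Finset.sum_le_sum fun i (_ : i ∈ Finset.univ) => h i
  simp_rw [← Finset.mul_sum] at this
  push_cast
  calc (2 : ℝ) ^ (-q) * ((Fintype.card ι : ℝ)⁻¹ * ∑ i, ‖x i‖ ^ q)
    _ ≤ (2 : ℝ) ^ (-q) * ((Fintype.card ι : ℝ)⁻¹ *
          ((Fintype.card ι : ℝ)⁻¹ * ∑ i, ∑ j, ‖x i - x j‖ ^ q)) := by gcongr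
    _ = _ := by field_simp

theorem meanNormRpow_midpoints_le [Nonempty ι] {p : ℝ} (hp : 1 ≤ p) {x : ι → E}
    (hx : ∑ i, x i = 0) : meanNormRpow (2 * p) (midpoints x) ≤
      (1 - (2 : ℝ) ^ (-(2 * p))) * meanNormRpow (2 * p) x := by
  have h1 := meanNormRpow_midpoints_add_halfDifferences_le hp x
  have h2 := two_rpow_mul_meanNormRpow_le (q := 2 * p) (by linarith) hx
  linarith

theorem sum_midpoints {x : ι → E} (hx : ∑ i, x i = 0) : ∑ q, midpoints x q = 0 := by
  simp [midpoints, Fintype.sum_prod_type, ← Finset.smul_sum, Finset.sum_add_distrib, hx,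
    ← Finset.smul_sum]

end Averages

section Mixture

variable {E : Type*} [NormedAddCommGroup E] [InnerProductSpace ℝ E] [FiniteDimensional ℝ E]
  [MeasurableSpace E] {ι : Type*} [Fintype ι]

/-- The equal-weight mixture of the Gaussians `N(xᵢ, I)`. -/
def gaussianMixture (x : ι → E) : Measure E :=
  (Fintype.card ι : ℝ≥0∞)⁻¹ • ∑ i, (ProbabilityTheory.stdGaussian E).map (x i + ·)

theorem gaussianMixture_eq_sum_prod [Nonempty ι] (x : ι → E) :
    gaussianMixture x = (Fintype.card (ι × ι) : ℝ≥0∞)⁻¹ • ∑ q : ι × ι, (2 : ℝ≥0∞)⁻¹ •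
      ((ProbabilityTheory.stdGaussian E).map (x q.1 + ·) +
        (ProbabilityTheory.stdGaussian E).map (x q.2 + ·)) := by
  have hN0 : (Fintype.card ι : ℝ≥0∞) ≠ 0 := by simp
  rw [← Finset.smul_sum, Fintype.sum_prod_type]
  simp only [Finset.sum_add_distrib, Finset.sum_const, Finset.card_univ]
  rw [← Finset.smul_sum, ← two_nsmul, ← Nat.cast_smul_eq_nsmul ℝ≥0∞,
    ← Nat.cast_smul_eq_nsmul ℝ≥0∞, smul_smul, smul_smul, smul_smul, gaussianMixture,
    Fintype.card_prod]
  congr 1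
  push_cast
  rw [ENNReal.mul_inv (by simp) (by simp), mul_assoc, mul_assoc, ← mul_assoc 2⁻¹ 2,
    ENNReal.inv_mul_cancel (by simp) (by simp), one_mul, mul_assoc,
    ENNReal.inv_mul_cancel hN0 (by simp), mul_one]

variable [BorelSpace E]

instance [Nonempty ι] (x : ι → E) : IsProbabilityMeasure (gaussianMixture x) := by
  have (i : ι) : IsProbabilityMeasure ((ProbabilityTheory.stdGaussian E).map (x i + ·)) :=
    Measure.isProbabilityMeasure_map (by fun_prop)
  refine ⟨?_⟩
  rw [gaussianMixture, Measure.smul_apply, Measure.finsetSum_apply]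
  simp only [measure_univ, Finset.sum_const, Finset.card_univ, nsmul_eq_mul, mul_one, smul_eq_mul]
  exact ENNReal.inv_mul_cancel (by simp) (by simp)

theorem Kconst_nonneg (p : ℝ) : 0 ≤ Kconst p := zero_le_one.trans (le_max_left _ _)

theorem transportCostLE_gaussianMixture_midpoints [Nonempty ι] {p : ℝ} (hp : 1 ≤ p) (x : ι → E) :
    TransportCostLE p (gaussianMixture x) (gaussianMixture (midpoints x))
      (ENNReal.ofReal (Kconst p * meanNormRpow (2 * p) x ^ (1 / p)) ^ p) := by
  have hp0 : 0 < p := by linarith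
  rw [gaussianMixture_eq_sum_prod]
  refine (TransportCostLE.smul_sum _ fun q : ι × ι => transportCostLE_pair hp (x q.1) (x q.2)).mono ?_
  have hterm (q : ι × ι) : ENNReal.ofReal (Kconst p * ‖(2⁻¹ : ℝ) • (x q.1 - x q.2)‖ ^ 2) ^ p =
      ENNReal.ofReal (Kconst p) ^ p * ‖halfDifferences x q‖ₑ ^ (2 * p) := by
    rw [ENNReal.ofReal_mul (Kconst_nonneg p), ENNReal.mul_rpow_of_nonneg _ _ hp0.le,
      ENNReal.rpow_mul, ENNReal.rpow_two, ENNReal.ofReal_pow (norm_nonneg _), ofReal_norm]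
    rfl
  simp_rw [hterm]
  rw [← Finset.mul_sum, mul_left_comm, inv_card_mul_sum_enorm_rpow (by positivity),
    ENNReal.ofReal_mul (Kconst_nonneg p), ENNReal.mul_rpow_of_nonneg _ _ hp0.le,
    ENNReal.ofReal_rpow_of_nonneg (Real.rpow_nonneg (meanNormRpow_nonneg _ _) _) hp0.le, one_div,
    Real.rpow_inv_rpow (meanNormRpow_nonneg _ _) hp0.ne']
  gcongr
  have h1 := meanNormRpow_midpoints_add_halfDifferences_le hp x
  have h2 := meanNormRpow_nonneg (2 * p) (midpoints x)
  linarith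

theorem transportCostLE_gaussianMixture_stdGaussian [Nonempty ι] {p : ℝ} (hp : 1 ≤ p)
    (x : ι → E) :
    TransportCostLE p (gaussianMixture x) (ProbabilityTheory.stdGaussian E)
      (ENNReal.ofReal (meanNormRpow (2 * p) x ^ (1 / (2 * p))) ^ p) := by
  have hp0 : 0 < p := by linarith
  have h := transportCostLE_translate p (Fintype.card ι : ℝ≥0∞)⁻¹
    (ProbabilityTheory.stdGaussian E) x
  have e : (Fintype.card ι : ℝ≥0∞)⁻¹ • ∑ _i : ι, ProbabilityTheory.stdGaussian E =
      ProbabilityTheory.stdGaussian E := by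
    rw [Finset.sum_const, Finset.card_univ, ← Nat.cast_smul_eq_nsmul ℝ≥0∞, smul_smul,
      ENNReal.inv_mul_cancel (by simp) (by simp), one_smul]
  simp only [measure_univ, mul_one] at h
  rw [e, inv_card_mul_sum_enorm_rpow hp0.le] at h
  refine h.mono ?_
  rw [ENNReal.ofReal_rpow_of_nonneg (Real.rpow_nonneg (meanNormRpow_nonneg _ _) _) hp0.le,
    ← Real.rpow_mul (meanNormRpow_nonneg _ _),
    show 1 / (2 * p) * p = 1 / 2 by field_simp]
  gcongr
  exact meanNormRpow_le_sqrt p x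

end Mixture

section Chaining

variable {E : Type*} [NormedAddCommGroup E] [InnerProductSpace ℝ E] [FiniteDimensional ℝ E]
  [MeasurableSpace E] [BorelSpace E]

theorem transportCostLE_gaussianMixture_geom {p : ℝ} (hp : 1 ≤ p) {R : ℝ}
    (hR : R = 1 - (2 : ℝ) ^ (-(2 * p))) (hR0 : 0 ≤ R) (k : ℕ) {ι : Type} [Fintype ι] [Nonempty ι]
    {x : ι → E} (hx : ∑ i, x i = 0) {S : ℝ} (hS : meanNormRpow (2 * p) x ≤ S) :
    TransportCostLE p (gaussianMixture x) (ProbabilityTheory.stdGaussian E)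
      (ENNReal.ofReal (Kconst p * S ^ (1 / p) * ∑ j ∈ Finset.range k, (R ^ (1 / p)) ^ j +
        (R ^ k * S) ^ (1 / (2 * p))) ^ p) := by
  induction k generalizing ι S with
  | zero =>
    refine (transportCostLE_gaussianMixture_stdGaussian hp x).mono ?_
    have := meanNormRpow_nonneg (2 * p) x
    simp only [Finset.range_zero, Finset.sum_empty, mul_zero, zero_add, pow_zero, one_mul]
    gcongr
  | succ k ih =>
    have h0 := meanNormRpow_nonneg (2 * p) x
    have hS0 : 0 ≤ S := h0.trans hS
    have hmid : meanNormRpow (2 * p) (midpoints x) ≤ R * S := by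
      refine (meanNormRpow_midpoints_le hp hx).trans ?_
      rw [← hR]
      gcongr
    refine ((transportCostLE_gaussianMixture_midpoints hp x).trans hp
      (ih (sum_midpoints hx) hmid)).mono ?_
    have hK := Kconst_nonneg p
    rw [← ENNReal.ofReal_add (by positivity) (by positivity)]
    refine ENNReal.rpow_le_rpow (ENNReal.ofReal_le_ofReal ?_) (by linarith)
    have h1 : Kconst p * meanNormRpow (2 * p) x ^ (1 / p) ≤ Kconst p * S ^ (1 / p) := by gcongr
    have h2 : (R * S) ^ (1 / p) = R ^ (1 / p) * S ^ (1 / p) := Real.mul_rpow hR0 hS0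
    have h3 : R ^ k * (R * S) = R ^ (k + 1) * S := by ring
    rw [Finset.sum_range_succ', h2, h3]
    simp only [pow_succ (R ^ (1 / p)), ← Finset.sum_mul, pow_zero]
    linarith

theorem Wp_gaussianMixture_le {p : ℝ} (hp : 1 ≤ p) {ι : Type} [Fintype ι] [Nonempty ι]
    {x : ι → E} (hx : ∑ i, x i = 0) :
    Wp p (gaussianMixture x) (ProbabilityTheory.stdGaussian E) ≤
      ENNReal.ofReal ((Kconst p / (1 - (1 - (2 : ℝ) ^ (-(2 * p))) ^ (1 / p))) *
        meanNormRpow (2 * p) x ^ (1 / p)) := by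
  have hp0 : 0 < p := by linarith
  obtain ⟨R, hR⟩ : ∃ R : ℝ, R = 1 - (2 : ℝ) ^ (-(2 * p)) := ⟨_, rfl⟩
  have hR0 : 0 ≤ R := by
    have := Real.rpow_le_one_of_one_le_of_nonpos (one_le_two (α := ℝ))
      (show -(2 * p) ≤ 0 by linarith)
    linarith
  have hR1 : R < 1 := by
    have := Real.rpow_pos_of_pos (two_pos (α := ℝ)) (-(2 * p))
    linarith
  have hr0 : 0 ≤ R ^ (1 / p) := by positivity
  have hr1 : R ^ (1 / p) < 1 := Real.rpow_lt_one hR0 hR1 (by positivity)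
  rw [← hR]
  set S := meanNormRpow (2 * p) x
  have hlim : Filter.Tendsto (fun k : ℕ => Kconst p * S ^ (1 / p) *
      ∑ j ∈ Finset.range k, (R ^ (1 / p)) ^ j + (R ^ k * S) ^ (1 / (2 * p))) Filter.atTop
      (nhds (Kconst p * S ^ (1 / p) * (1 - R ^ (1 / p))⁻¹ + (0 * S) ^ (1 / (2 * p)))) :=
    ((hasSum_geometric_of_lt_one hr0 hr1).tendsto_sum_nat.const_mul _).add
      (((tendsto_pow_atTop_nhds_zero_of_lt_one hR0 hR1).mul_const S).rpow_const
        (Or.inr (by positivity)))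
  rw [zero_mul, Real.zero_rpow (by positivity), add_zero, mul_right_comm, ← div_eq_mul_inv] at hlim
  refine ge_of_tendsto' (ENNReal.tendsto_ofReal hlim) fun k => ?_
  refine ((transportCostLE_gaussianMixture_geom hp hR hR0 k hx le_rfl).Wp_le hp0.le).trans ?_
  rw [one_div p, ENNReal.rpow_rpow_inv hp0.ne', ← one_div]

end Chaining

theorem stdGaussian_eq (d : ℕ) :
    _root_.stdGaussian d = ProbabilityTheory.stdGaussian (EuclideanSpace ℝ (Fin d)) :=
  map_pi_eq_stdGaussian

/-- chaining bound from a centred Gaussian mixture to the standard Gaussian. -/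
theorem wasserstein_mixture_to_gaussian
    (n : ℕ) (hn : 0 < n) (d : ℕ) (p : ℝ) (hp : 1 ≤ p)
    (x : Fin (2 * n) → EuclideanSpace ℝ (Fin d))
    (hsum : ∑ i, x i = 0) :
    Wp p (((2 * n : ℝ≥0∞))⁻¹ • ∑ i, gaussianE d (x i)) (stdGaussian d) ≤
      ENNReal.ofReal
        ((Kconst p / (1 - (1 - (2 : ℝ) ^ (-(2 * p))) ^ (1 / p))) *
          ((1 / (2 * n)) * ∑ i, ‖x i‖ ^ (2 * p)) ^ (1 / p)) := by
  have : NeZero n := ⟨hn.ne'⟩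
  have : Nonempty (Fin (2 * n)) := ⟨⟨0, by omega⟩⟩
  have h := Wp_gaussianMixture_le hp hsum
  simp only [gaussianMixture, meanNormRpow, Fintype.card_fin, Nat.cast_mul, Nat.cast_ofNat] at h
  simp only [gaussianE, stdGaussian_eq, one_div (2 * (n : ℝ))]
  exact h

end
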